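/- Let Θ = (α, ρ_r, ρ_d, ρ_s, ρ_0, T) be a parameter tuple with β := ρ_d/ρ_r, δ := ρ_s/ρ_r satisfying min(T/4, 1/(3·ρ_0/ρ_r), 3β/(2·ρ_0/ρ_r)) > 10, and let R > 0 satisfy (D.1) ρ_r > α/(2δ), (D.2) ρ_r > (3α/(4(1+β)²·R))·g(4R/(3·K_max(Θ)))², and (D.3) ρ_r < (α/(1+β)²)·g(R)²/R. Then ζ'_zf(R,Θ) > (3/8)·ζ'_csi(4R/3, Θ) > (3/8)·ζ'_csi(R, Θ). -/

import Mathlib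

open Real

/-- Uplink SINR-like quantity γ_u(M,K,τ,R,T). -/
noncomputable def gammaU (M K τ R T : ℝ) : ℝ :=
  ((K + τ) * ((2:ℝ) ^ (R / (K * (1 - τ / T))) - 1)) / (2 * τ * (M - K)) +
    Real.sqrt ((((K + τ) * ((2:ℝ) ^ (R / (K * (1 - τ / T))) - 1)) / (2 * τ * (M - K))) ^ 2 +
      ((2:ℝ) ^ (R / (K * (1 - τ / T))) - 1) / (τ * (M - K)))

/-- Total normalized power consumption P(M,K,τ,R,Θ). -/
noncomputable def Ptot (M K τ R α ρr ρd ρs ρ0 T : ℝ) : ℝ :=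
  α * K * gammaU M K τ R T + ρs + K * (ρd + (8/3) * K ^ 2 * ρ0 / T) +
    M * (ρr + 2 * K * ρ0 + 4 * K ^ 2 * ρ0 / T)

/-- Optimal normalized energy efficiency ζ*_zf(R,Θ) (integer optimization). -/
noncomputable def zetaZfStar (R α ρr ρd ρs ρ0 T : ℝ) : ℝ :=
  R / sInf {p : ℝ | ∃ M K τ : ℤ, 1 ≤ K ∧ K ≤ τ ∧ (τ : ℝ) < T ∧ K < M ∧
    p = Ptot (M : ℝ) (K : ℝ) (τ : ℝ) R α ρr ρd ρs ρ0 T}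

/-- Maximum number of users K_max(Θ). -/
noncomputable def Kmax (ρr ρd ρ0 T : ℝ) : ℝ :=
  min (T / 4) (min (ρr / (3 * ρ0)) (3 * ρd / (2 * ρ0)))

/-- The function g(x). -/
noncomputable def gfun (x : ℝ) : ℝ :=
  Real.sqrt (x / ((2:ℝ) ^ x - 1)) * ((2:ℝ) ^ x * x * Real.log 2 - (2:ℝ) ^ x + 1)

/-- Ideal (perfect CSI) power consumption P_csi(M,K,R,Θ). -/
noncomputable def Pcsi (M K R α ρr ρd ρs : ℝ) : ℝ :=
  α * K * ((2:ℝ) ^ (R / K) - 1) / (M - K) + M * ρr + K * ρd + ρs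

/-- Relaxed (real-valued) optimal EE ζ'_zf(R,Θ) with K ≤ K_max(Θ). -/
noncomputable def zetaZfPrime (R α ρr ρd ρs ρ0 T : ℝ) : ℝ :=
  R / sInf {p : ℝ | ∃ M K τ : ℝ, 1 ≤ K ∧ K ≤ Kmax ρr ρd ρ0 T ∧ K ≤ τ ∧ τ < T ∧ K < M ∧
    p = Ptot M K τ R α ρr ρd ρs ρ0 T}

/-- Optimal EE of the ideal perfect-CSI system ζ'_csi(R,Θ). -/
noncomputable def zetaCsiPrime (R α ρr ρd ρs ρ0 T : ℝ) : ℝ :=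
  R / sInf {p : ℝ | ∃ M K : ℝ, 1 ≤ K ∧ K ≤ Kmax ρr ρd ρ0 T ∧ K < M ∧
    p = Pcsi M K R α ρr ρd ρs}

/-- Relaxed optimal EE with the number of users fixed to K. -/
noncomputable def zetaZfFixedK (K R α ρr ρd ρs ρ0 T : ℝ) : ℝ :=
  R / sInf {p : ℝ | ∃ M τ : ℝ, K < M ∧ K ≤ τ ∧ τ < T ∧
    p = Ptot M K τ R α ρr ρd ρs ρ0 T}

/-- The function `x ↦ x * exp x / (exp x - 1)` is monotone on the positive reals. -/
lemma mul_exp_div_exp_sub_one_le {x y : ℝ} (hx : 0 < x) (hxy : x ≤ y) :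
    x * exp x / (exp x - 1) ≤ y * exp y / (exp y - 1) := by
  have hy : 0 < y := hx.trans_le hxy
  have hex : 0 < exp x - 1 := by linarith [Real.add_one_lt_exp hx.ne']
  have hey : 0 < exp y - 1 := by linarith [Real.add_one_lt_exp hy.ne']
  rw [div_le_div_iff₀ hex hey]
  set d := y - x with hd
  have hyd : y = x + d := by rw [hd]; ring
  have hd0 : 0 ≤ d := by linarith
  have h1 : d + 1 ≤ exp d := Real.add_one_le_exp d
  have h2 : x ≤ exp x - 1 := by linarith [Real.add_one_le_exp x]
  have h3 : 1 - d ≤ exp (-d) := by linarith [Real.add_one_le_exp (-d)]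
  have h4 : exp d * exp (-d) = 1 := by rw [← Real.exp_add]; simp
  have h5 : exp d - 1 ≤ d * exp d := by
    nlinarith [mul_le_mul_of_nonneg_left h3 (Real.exp_pos d).le]
  have key : x * (exp d - 1) ≤ d * exp d * (exp x - 1) :=
    calc x * (exp d - 1) ≤ x * (d * exp d) := by gcongr
      _ ≤ (exp x - 1) * (d * exp d) := by gcongr
      _ = _ := by ring
  rw [hyd, Real.exp_add]
  nlinarith [mul_le_mul_of_nonneg_left key (Real.exp_pos x).le]

lemma log_exp_sub_one_div_sub_le {t y : ℝ} (ht : 0 < t) (hty : t ≤ y) :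
    log ((exp y - 1) / y) - log ((exp t - 1) / t) ≤
      (y / t - 1) * (y * exp y / (exp y - 1) - 1) := by
  rcases hty.eq_or_lt with rfl | hlt
  · simp [div_self ht.ne']
  have hpos : ∀ z, 0 < z → 0 < exp z - 1 := fun z hz => by
    linarith [Real.add_one_lt_exp hz.ne']
  have hderiv : ∀ z, 0 < z → HasDerivAt (fun z => log ((exp z - 1) / z))
      ((z * exp z / (exp z - 1) - 1) / z) z := by
    intro z hz
    have hE := hpos z hz
    have h := ((((Real.hasDerivAt_exp z).sub_const 1).fun_div (hasDerivAt_id' z) hz.ne').log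
      (div_pos hE hz).ne')
    convert h using 1
    field_simp
  obtain ⟨ξ, ⟨h1, h2⟩, h3⟩ := exists_hasDerivAt_eq_slope
    (fun z => log ((exp z - 1) / z)) (fun z => (z * exp z / (exp z - 1) - 1) / z) hlt
    (fun z hz => (hderiv z (ht.trans_le hz.1)).continuousAt.continuousWithinAt)
    (fun z hz => hderiv z (ht.trans hz.1))
  have hξ : 0 < ξ := ht.trans h1
  rw [eq_div_iff (by linarith)] at h3
  rw [← h3]
  have hq := mul_exp_div_exp_sub_one_le hξ h2.le
  have hq0 : 0 ≤ ξ * exp ξ / (exp ξ - 1) - 1 := by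
    rw [sub_nonneg, le_div_iff₀ (hpos ξ hξ)]
    have : exp ξ * exp (-ξ) = 1 := by rw [← Real.exp_add]; simp
    nlinarith [mul_le_mul_of_nonneg_left (Real.add_one_le_exp (-ξ)) (Real.exp_pos ξ).le]
  calc (ξ * exp ξ / (exp ξ - 1) - 1) / ξ * (y - t)
      ≤ (y * exp y / (exp y - 1) - 1) / t * (y - t) := by
        have : 0 ≤ y - t := by linarith
        gcongr
        linarith
    _ = _ := by field_simp

/-- Tangent line bound at `s = 1` for the convex function `s ↦ √(s * (exp (y / s) - 1))`. -/
lemma sqrt_perspective_tangent {y s : ℝ} (hy : 0 < y) (hs : 1 ≤ s) :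
    2 * (√(exp y - 1) - √(s * (exp (y / s) - 1))) * √(exp y - 1) ≤
      (s - 1) * (y * exp y - (exp y - 1)) := by
  have hs0 : 0 < s := by linarith
  have ht : 0 < y / s := div_pos hy hs0
  have hD : 0 < exp y - 1 := by linarith [Real.add_one_lt_exp hy.ne']
  have hE : 0 < exp (y / s) - 1 := by linarith [Real.add_one_lt_exp ht.ne']
  have h := log_exp_sub_one_div_sub_le ht (div_le_self hy.le hs)
  set D := exp y - 1
  set F := s * (exp (y / s) - 1) with hF
  have hF0 : 0 < F := mul_pos hs0 hE
  have e1 : (exp (y / s) - 1) / (y / s) = F / y := by rw [hF]; field_simp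
  have e2 : y / (y / s) = s := by field_simp
  rw [e1, e2, Real.log_div hD.ne' hy.ne', Real.log_div hF0.ne' hy.ne'] at h
  have h2 : 1 - √F / √D ≤ (log D - log F) / 2 := by
    have := Real.log_le_sub_one_of_pos (div_pos (Real.sqrt_pos.2 hF0) (Real.sqrt_pos.2 hD))
    rw [Real.log_div (Real.sqrt_pos.2 hF0).ne' (Real.sqrt_pos.2 hD).ne', Real.log_sqrt hF0.le,
      Real.log_sqrt hD.le] at this
    linarith
  have hsD := Real.sqrt_pos.2 hD
  have h3 : 2 * (1 - √F / √D) ≤ (s - 1) * (y * exp y / D - 1) := by linarith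
  have h4 := mul_le_mul_of_nonneg_right h3 hD.le
  have e3 : (s - 1) * (y * exp y / D - 1) * D = (s - 1) * (y * exp y - D) := by field_simp
  have e4 : 2 * (1 - √F / √D) * D = 2 * (√D - √F) * √D := by
    nth_rewrite 2 [← Real.mul_self_sqrt hD.le]
    field_simp
  linarith

lemma sInf_le_mul_sInf_sub {S S' : Set ℝ} {k c : ℝ} (hk : 0 < k) (hS : BddBelow S)
    (hne : S'.Nonempty) (h : ∀ p' ∈ S', ∃ p ∈ S, p ≤ k * p' - c) :
    sInf S ≤ k * sInf S' - c := by
  have : (sInf S + c) / k ≤ sInf S' := le_csInf hne fun p' hp' => by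
    obtain ⟨p, hp, hle⟩ := h p' hp'
    rw [div_le_iff₀ hk]
    linarith [csInf_le hS hp]
  rw [div_le_iff₀ hk] at this
  linarith

lemma two_rpow_sub_one_pos {x : ℝ} (hx : 0 < x) : 0 < (2 : ℝ) ^ x - 1 := by
  linarith [Real.one_lt_rpow (x := 2) (by norm_num) hx]

lemma le_Pcsi {M K R α ρr ρd ρs : ℝ} (hα : 0 < α) (hρr : 0 < ρr) (hρd : 0 < ρd)
    (hR : 0 < R) (hK : 0 < K) (hM : K < M) : ρs ≤ Pcsi M K R α ρr ρd ρs := by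
  have := two_rpow_sub_one_pos (div_pos hR hK)
  have hMK : 0 < M - K := by linarith
  have hM0 : 0 < M := by linarith
  unfold Pcsi
  have : 0 ≤ α * K * ((2 : ℝ) ^ (R / K) - 1) / (M - K) + M * ρr + K * ρd := by positivity
  linarith

lemma le_Ptot {M K τ R α ρr ρd ρs ρ0 T : ℝ} (hα : 0 < α) (hρr : 0 < ρr) (hρd : 0 < ρd)
    (hρ0 : 0 < ρ0) (hR : 0 < R) (hK : 0 < K) (hKτ : K ≤ τ) (hτ : τ < T) (hM : K < M) :
    ρs ≤ Ptot M K τ R α ρr ρd ρs ρ0 T := by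
  have hτ0 : 0 < τ := by linarith
  have hT : 0 < T := by linarith
  have h1 : 0 < 1 - τ / T := by rw [sub_pos, div_lt_one hT]; exact hτ
  have := two_rpow_sub_one_pos (div_pos hR (mul_pos hK h1))
  have hMK : 0 < M - K := by linarith
  have hM0 : 0 < M := by linarith
  have hγ : 0 ≤ gammaU M K τ R T := by unfold gammaU; positivity
  unfold Ptot
  have : 0 ≤ α * K * gammaU M K τ R T + K * (ρd + (8/3) * K ^ 2 * ρ0 / T) +
    M * (ρr + 2 * K * ρ0 + 4 * K ^ 2 * ρ0 / T) := by positivity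
  linarith

/-- With a quarter of the frame used for training, the uplink quantity is at most twice the
perfect-CSI one plus a correction. -/
lemma gammaU_quarter_le {M K R T : ℝ} (hR : 0 < R) (hK : 0 < K) (hKT : K ≤ T / 4)
    (hM : K < M) :
    gammaU M K (T / 4) R T ≤
      2 * (((2 : ℝ) ^ (4 * R / 3 / K) - 1) / (M - K)) + 1 / (2 * (T / 4)) := by
  have hT : 0 < T := by linarith
  have hMK : 0 < M - K := by linarith
  have e : R / (K * (1 - T / 4 / T)) = 4 * R / 3 / K := by field_simp; norm_num
  unfold gammaU
  rw [e]
  have hE := two_rpow_sub_one_pos (div_pos (by linarith : 0 < 4 * R / 3) hK)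
  set E := (2 : ℝ) ^ (4 * R / 3 / K) - 1
  set τ := T / 4 with hτ
  have hτ0 : 0 < τ := by positivity
  set a := E / (M - K) with ha
  have ha0 : 0 < a := div_pos hE hMK
  have e1 : (K + τ) * E / (2 * τ * (M - K)) = (K + τ) / (2 * τ) * a := by rw [ha]; field_simp
  have e2 : E / (τ * (M - K)) = a / τ := by rw [ha]; field_simp
  rw [e1, e2]
  have h1 : (K + τ) / (2 * τ) ≤ 1 := by rw [div_le_one (by positivity)]; linarith
  have h2 : (K + τ) / (2 * τ) * a ≤ a := mul_le_of_le_one_left ha0.le h1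
  have h3 : √(((K + τ) / (2 * τ) * a) ^ 2 + a / τ) ≤ a + 1 / (2 * τ) := by
    apply Real.sqrt_le_iff.2 ⟨by positivity, ?_⟩
    have h4 : ((K + τ) / (2 * τ) * a) ^ 2 ≤ a ^ 2 := pow_le_pow_left₀ (by positivity) h2 2
    have h5 : (a + 1 / (2 * τ)) ^ 2 = a ^ 2 + a / τ + (1 / (2 * τ)) ^ 2 := by field_simp; ring
    rw [h5]
    linarith [sq_nonneg (1 / (2 * τ))]
  linarith

lemma Ptot_quarter_le {M K R α ρr ρd ρs ρ0 T : ℝ} (hα : 0 < α) (hρ0 : 0 < ρ0) (hR : 0 < R)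
    (hK : 0 < K) (hM : K < M) (hKT : K ≤ T / 4) (hKr : K * ρ0 ≤ ρr / 3)
    (hKd : K * ρ0 ≤ 3 * ρd / 2) :
    Ptot M K (T / 4) R α ρr ρd ρs ρ0 T ≤
      2 * Pcsi M K (4 * R / 3) α ρr ρd ρs - (ρs - α / 2) := by
  have hT : 0 < T := by linarith
  have h1 := mul_le_mul_of_nonneg_left (gammaU_quarter_le hR hK hKT hM) (mul_pos hα hK).le
  have h2 : α * K * (1 / (2 * (T / 4))) ≤ α / 2 := by
    rw [mul_one_div, div_le_div_iff₀ (by positivity) (by norm_num)]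
    nlinarith
  have h3 : K ^ 2 * ρ0 / T ≤ K * ρ0 / 4 := by
    rw [div_le_div_iff₀ hT (by norm_num)]
    nlinarith [mul_pos hK hρ0]
  have h4 : K * ((8/3) * K ^ 2 * ρ0 / T) ≤ K * ρd := by
    apply mul_le_mul_of_nonneg_left _ hK.le
    have : (8/3) * K ^ 2 * ρ0 / T = (8/3) * (K ^ 2 * ρ0 / T) := by ring
    linarith
  have h5 : M * (2 * K * ρ0 + 4 * K ^ 2 * ρ0 / T) ≤ M * ρr := by
    apply mul_le_mul_of_nonneg_left _ (by linarith)
    have : 4 * K ^ 2 * ρ0 / T = 4 * (K ^ 2 * ρ0 / T) := by ring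
    linarith
  unfold Ptot Pcsi
  have e : α * K * ((2 : ℝ) ^ (4 * R / 3 / K) - 1) / (M - K) =
    α * K * (((2 : ℝ) ^ (4 * R / 3 / K) - 1) / (M - K)) := by ring
  rw [e]
  linarith

/-- Optimizing the number of antennas for a fixed number of users: lower bound. -/
lemma sqrt_le_Pcsi {M K R α ρr ρd ρs : ℝ} (hα : 0 < α) (hρr : 0 < ρr) (hR : 0 < R)
    (hK : 0 < K) (hM : K < M) :
    2 * √(α * ρr * (K * ((2 : ℝ) ^ (R / K) - 1))) + K * (ρr + ρd) + ρs ≤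
      Pcsi M K R α ρr ρd ρs := by
  have hE := two_rpow_sub_one_pos (div_pos hR hK)
  have hMK : 0 < M - K := by linarith
  unfold Pcsi
  set E := (2 : ℝ) ^ (R / K) - 1
  have h1 : √(α * ρr * (K * E)) ≤ (α * K * E / (M - K) + (M - K) * ρr) / 2 := by
    apply Real.sqrt_le_iff.2 ⟨by positivity, ?_⟩
    have : α * ρr * (K * E) = (α * K * E / (M - K)) * ((M - K) * ρr) := by field_simp
    rw [this]
    nlinarith [sq_nonneg (α * K * E / (M - K) - (M - K) * ρr)]
  linarith

/-- Optimizing the number of antennas for a fixed number of users: the bound is attained. -/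
lemma exists_Pcsi_eq_sqrt {K R α ρr ρd ρs : ℝ} (hα : 0 < α) (hρr : 0 < ρr) (hR : 0 < R)
    (hK : 0 < K) : ∃ M, K < M ∧ Pcsi M K R α ρr ρd ρs =
      2 * √(α * ρr * (K * ((2 : ℝ) ^ (R / K) - 1))) + K * (ρr + ρd) + ρs := by
  have hE := two_rpow_sub_one_pos (div_pos hR hK)
  set E := (2 : ℝ) ^ (R / K) - 1 with hEdef
  have hX : 0 < α * ρr * (K * E) := by positivity
  have hS := Real.sqrt_pos.2 hX
  refine ⟨K + √(α * ρr * (K * E)) / ρr, by linarith [div_pos hS hρr], ?_⟩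
  unfold Pcsi
  rw [← hEdef]
  have hsq := Real.sq_sqrt hX.le
  set S := √(α * ρr * (K * E))
  have : α * K * E / (K + S / ρr - K) = S := by
    rw [add_sub_cancel_left]
    field_simp
    linarith
  rw [this]
  field_simp
  ring

lemma gfun_sq_mul {x : ℝ} (hx : 0 < x) :
    gfun x ^ 2 = x / (exp (x * log 2) - 1) *
      (x * log 2 * exp (x * log 2) - (exp (x * log 2) - 1)) ^ 2 := by
  have h := two_rpow_sub_one_pos hx
  have e : (2 : ℝ) ^ x = exp (x * log 2) := by
    rw [Real.rpow_def_of_pos (by norm_num), mul_comm]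
  unfold gfun
  rw [mul_pow, Real.sq_sqrt (by positivity), e]
  ring

/-- Scaling the sum rate by `4 / 3` scales the perfect-CSI power by less than `4 / 3`. -/
lemma exists_Pcsi_scaled_le {M K A R α ρr ρd ρs : ℝ} (hα : 0 < α) (hρr : 0 < ρr)
    (hρd : 0 < ρd) (hR : 0 < R) (hK : 1 ≤ K) (hKA : K ≤ A) (hM : K < M)
    (hD2 : ρr > 3 * α / (4 * (1 + ρd / ρr) ^ 2 * R) * (gfun (4 * R / (3 * A))) ^ 2) :
    ∃ M' K', 1 ≤ K' ∧ K' ≤ A ∧ K' < M' ∧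
      Pcsi M' K' (4 * R / 3) α ρr ρd ρs ≤ 4 / 3 * Pcsi M K R α ρr ρd ρs - ρs / 3 := by
  have hK0 : 0 < K := by linarith
  have hA : 0 < A := by linarith
  have hMK : 0 < M - K := by linarith
  by_cases hcase : 4 / 3 * K ≤ A
  · refine ⟨4 / 3 * M, 4 / 3 * K, by linarith, hcase, by linarith, ?_⟩
    have hE := two_rpow_sub_one_pos (div_pos hR hK0)
    unfold Pcsi
    have e : 4 * R / 3 / (4 / 3 * K) = R / K := by field_simp
    have e2 : α * (4 / 3 * K) * ((2 : ℝ) ^ (R / K) - 1) / (4 / 3 * M - 4 / 3 * K) =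
        α * K * ((2 : ℝ) ^ (R / K) - 1) / (M - K) := by
      rw [← mul_sub]; field_simp
    rw [e, e2]
    have : 0 < α * K * ((2 : ℝ) ^ (R / K) - 1) / (M - K) := by positivity
    linarith
  · push Not at hcase
    obtain ⟨M', hM', hP⟩ := exists_Pcsi_eq_sqrt (R := 4 * R / 3) (ρd := ρd) (ρs := ρs)
      hα hρr (by linarith) hA
    refine ⟨M', A, by linarith, le_rfl, hM', ?_⟩
    have hlow := sqrt_le_Pcsi (ρd := ρd) (ρs := ρs) hα hρr hR hK0 hM
    rw [hP]
    have hx : 0 < 4 * R / (3 * A) := by positivity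
    have hg := gfun_sq_mul hx
    have e0 : 4 * R / 3 / A = 4 * R / (3 * A) := by field_simp
    set x := 4 * R / (3 * A) with hxdef
    set s := 4 / 3 * K / A with hsdef
    have hs1 : 1 ≤ s := by rw [hsdef, le_div_iff₀ hA]; linarith
    have hs0 : 0 < s := by linarith
    set y := x * log 2 with hydef
    have hy : 0 < y := mul_pos hx (Real.log_pos (by norm_num))
    have e1 : (2 : ℝ) ^ (4 * R / 3 / A) = exp y := by
      rw [e0, Real.rpow_def_of_pos (by norm_num), mul_comm]
    have e2 : (2 : ℝ) ^ (R / K) = exp (y / s) := by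
      rw [Real.rpow_def_of_pos (by norm_num), hydef, hsdef, hxdef]
      congr 1
      field_simp
    have htan := sqrt_perspective_tangent hy hs1
    have hD : 0 < exp y - 1 := by linarith [Real.add_one_lt_exp hy.ne']
    have hE : 0 < exp (y / s) - 1 := sub_pos.2 (Real.one_lt_exp_iff.2 (div_pos hy hs0))
    rw [e1]
    rw [e2] at hlow
    set D := exp y - 1
    set E := exp (y / s) - 1
    set G := y * exp y - D
    set N := √(α * ρr * A) with hN
    have hN0 : 0 < N := Real.sqrt_pos.2 (by positivity)
    have hNsq : N ^ 2 = α * ρr * A := Real.sq_sqrt (by positivity)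
    have hsD : 0 < √D := Real.sqrt_pos.2 hD
    have f1 : √(α * ρr * (A * D)) = N * √D := by
      rw [← mul_assoc, Real.sqrt_mul (by positivity)]
    have f2 : N * √(s * E) ≤ 4 / 3 * √(α * ρr * (K * E)) := by
      rw [hN, ← Real.sqrt_mul (by positivity)]
      apply Real.sqrt_le_iff.2 ⟨by positivity, ?_⟩
      rw [mul_pow, Real.sq_sqrt (by positivity)]
      have : α * ρr * A * (s * E) = 4 / 3 * (α * ρr * (K * E)) := by rw [hsdef]; field_simp
      have h0 : 0 < α * ρr * (K * E) := by positivity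
      rw [this]
      linarith
    have f3 : N * G ≤ A * (ρr + ρd) * √D := by
      apply le_of_sq_le_sq _ (by positivity)
      rw [mul_pow, mul_pow, Real.sq_sqrt hD.le, hNsq]
      rw [hg] at hD2
      have : 3 * α / (4 * (1 + ρd / ρr) ^ 2 * R) * (x / D * G ^ 2) =
          ρr * (α * ρr * A * G ^ 2 / ((A * (ρr + ρd)) ^ 2 * D)) := by
        rw [hxdef]; field_simp
      rw [this, gt_iff_lt, mul_lt_iff_lt_one_right hρr, div_lt_one (by positivity)] at hD2
      exact hD2.le
    have f4 : 2 * N * (√D - √(s * E)) ≤ (s - 1) * (A * (ρr + ρd)) := by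
      have h1 := mul_le_mul_of_nonneg_left htan hN0.le
      have h2 := mul_le_mul_of_nonneg_left f3 (by linarith : 0 ≤ s - 1)
      refine le_of_mul_le_mul_right ?_ hsD
      linarith
    have f5 : s * A = 4 / 3 * K := by rw [hsdef]; field_simp
    rw [f1]
    have f6 : (s - 1) * (A * (ρr + ρd)) = 4 / 3 * (K * (ρr + ρd)) - A * (ρr + ρd) := by
      rw [sub_mul, ← mul_assoc, f5]; ring
    linarith

/-- lower bound ζ'_zf(R,Θ) > (3/8)·ζ'_csi(4R/3,Θ) > (3/8)·ζ'_csi(R,Θ)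
(Lemma 7). -/
theorem stmt_12 (α ρr ρd ρs ρ0 T R : ℝ)
    (hα : 1 < α) (hρr : 0 < ρr) (hρd : 0 < ρd) (hρs : 0 < ρs) (hρ0 : 0 < ρ0) (hT : 1 < T)
    (hcond : 10 < min (T / 4)
      (min (1 / (3 * (ρ0 / ρr))) (3 * (ρd / ρr) / (2 * (ρ0 / ρr)))))
    (hR : 0 < R)
    (hD1 : ρr > α / (2 * (ρs / ρr)))
    (hD2 : ρr > 3 * α / (4 * (1 + ρd / ρr) ^ 2 * R) *
      (gfun (4 * R / (3 * Kmax ρr ρd ρ0 T))) ^ 2)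
    (hD3 : ρr < α / (1 + ρd / ρr) ^ 2 * (gfun R) ^ 2 / R) :
    (3/8) * zetaCsiPrime (4 * R / 3) α ρr ρd ρs ρ0 T < zetaZfPrime R α ρr ρd ρs ρ0 T ∧
      (3/8) * zetaCsiPrime R α ρr ρd ρs ρ0 T <
        (3/8) * zetaCsiPrime (4 * R / 3) α ρr ρd ρs ρ0 T := by
  have hα0 : 0 < α := by linarith
  have hρs' : α / 2 < ρs := by
    rw [gt_iff_lt, div_lt_iff₀ (by positivity)] at hD1
    have : ρr * (2 * (ρs / ρr)) = 2 * ρs := by field_simp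
    linarith
  have hA : 1 < Kmax ρr ρd ρ0 T := by
    unfold Kmax
    rw [show 1 / (3 * (ρ0 / ρr)) = ρr / (3 * ρ0) by field_simp,
      show 3 * (ρd / ρr) / (2 * (ρ0 / ρr)) = 3 * ρd / (2 * ρ0) by field_simp] at hcond
    linarith
  have hAT : Kmax ρr ρd ρ0 T ≤ T / 4 := min_le_left _ _
  have hAr : Kmax ρr ρd ρ0 T ≤ ρr / (3 * ρ0) := (min_le_right _ _).trans (min_le_left _ _)
  have hAd : Kmax ρr ρd ρ0 T ≤ 3 * ρd / (2 * ρ0) := (min_le_right _ _).trans (min_le_right _ _)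
  unfold zetaZfPrime zetaCsiPrime
  set A := Kmax ρr ρd ρ0 T
  set S := {p : ℝ | ∃ M K τ : ℝ, 1 ≤ K ∧ K ≤ A ∧ K ≤ τ ∧ τ < T ∧ K < M ∧
    p = Ptot M K τ R α ρr ρd ρs ρ0 T}
  set C₁ := {p : ℝ | ∃ M K : ℝ, 1 ≤ K ∧ K ≤ A ∧ K < M ∧
    p = Pcsi M K (4 * R / 3) α ρr ρd ρs}
  set C := {p : ℝ | ∃ M K : ℝ, 1 ≤ K ∧ K ≤ A ∧ K < M ∧
    p = Pcsi M K R α ρr ρd ρs}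
  have hSlb : ∀ p ∈ S, ρs ≤ p := by
    rintro p ⟨M, K, τ, h1, -, h3, h4, h5, rfl⟩
    exact le_Ptot hα0 hρr hρd hρ0 hR (by linarith) h3 h4 h5
  have hC₁lb : ∀ p ∈ C₁, ρs ≤ p := by
    rintro p ⟨M, K, h1, -, h3, rfl⟩
    exact le_Pcsi hα0 hρr hρd (by linarith) (by linarith) h3
  have hClb : ∀ p ∈ C, ρs ≤ p := by
    rintro p ⟨M, K, h1, -, h3, rfl⟩
    exact le_Pcsi hα0 hρr hρd hR (by linarith) h3
  have hSne : S.Nonempty :=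
    ⟨_, 2, 1, T / 4, le_rfl, hA.le, by linarith, by linarith, by norm_num, rfl⟩
  have hC₁ne : C₁.Nonempty := ⟨_, 2, 1, le_rfl, hA.le, by norm_num, rfl⟩
  have hCne : C.Nonempty := ⟨_, 2, 1, le_rfl, hA.le, by norm_num, rfl⟩
  have hS0 : ρs ≤ sInf S := le_csInf hSne hSlb
  have hC₁0 : ρs ≤ sInf C₁ := le_csInf hC₁ne hC₁lb
  have hC0 : ρs ≤ sInf C := le_csInf hCne hClb
  have key₁ : sInf S ≤ 2 * sInf C₁ - (ρs - α / 2) := by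
    refine sInf_le_mul_sInf_sub (by norm_num) ⟨ρs, hSlb⟩ hC₁ne ?_
    rintro p ⟨M, K, h1, h2, h3, rfl⟩
    refine ⟨_, ⟨M, K, T / 4, h1, h2, h2.trans hAT, by linarith, h3, rfl⟩, ?_⟩
    have h4 := h2.trans hAr
    have h5 := h2.trans hAd
    rw [le_div_iff₀ (by positivity)] at h4 h5
    exact Ptot_quarter_le hα0 hρ0 hR (by linarith) h3 (h2.trans hAT) (by linarith) (by linarith)
  have key₂ : sInf C₁ ≤ 4 / 3 * sInf C - ρs / 3 := by
    refine sInf_le_mul_sInf_sub (by norm_num) ⟨ρs, hC₁lb⟩ hCne ?_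
    rintro p ⟨M, K, h1, h2, h3, rfl⟩
    obtain ⟨M', K', g1, g2, g3, g4⟩ :=
      exists_Pcsi_scaled_le (ρs := ρs) hα0 hρr hρd hR h1 h2 h3 hD2
    exact ⟨_, ⟨M', K', g1, g2, g3, rfl⟩, g4⟩
  have pS : 0 < sInf S := by linarith
  have pC₁ : 0 < sInf C₁ := by linarith
  have pC : 0 < sInf C := by linarith
  constructor
  · rw [← mul_div_assoc, div_lt_div_iff₀ pC₁ pS]
    nlinarith
  · refine mul_lt_mul_of_pos_left ?_ (by norm_num)
    rw [div_lt_div_iff₀ pC pC₁]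
    nlinarith
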